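/- Fix k ≥ 2, a permutation π of {1,...,k}, real numbers ε > 0, δ₀ > 0, and Δ₀ > 0. There exists a constant C (depending only on π, k, ε, δ₀, Δ₀) such that the following holds for all positive integers n and L with k ≤ L ≤ n. Let Λ be a k-uniform hypergraph on vertex set {1,...,n}, and suppose there is a collection of L-element subsets of {1,...,n}, each of which is a clique of Λ (every k-element subset of it is an edge of Λ), such that each vertex of {1,...,n} belongs to at least δ₀ and at most Δ₀ of the subsets in the collection. Then the number of permutations σ of {1,...,n} that Λ-avoid π is at most (C·n·(log n)^(2+ε)/L)^n. -/

import Mathlib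

/-- `σ` `Λ`-avoids `π`, where `Λ` is a hypergraph on `{1,…,n}` given as a finite
set of edges: there is no copy of `π` in `σ` whose index set is an edge of `Λ`. -/
def LambdaAvoids {k n : ℕ} (π : Equiv.Perm (Fin k))
    (Λ : Finset (Finset (Fin n))) (σ : Equiv.Perm (Fin n)) : Prop :=
  ¬ ∃ x : Fin k → Fin n,
      StrictMono x ∧ (∀ i j, π i < π j ↔ σ (x i) < σ (x j)) ∧
      Finset.image x Finset.univ ∈ Λ

/-- The point set `A` contains the pattern `π`: some `k` of its points, in general position, are in
the relative order prescribed by `π`. -/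
def HasPattern {α β : Type*} [Preorder α] [Preorder β] {k : ℕ} (π : Equiv.Perm (Fin k))
    (A : Finset (α × β)) : Prop :=
  ∃ (c : Fin k → α) (r : Fin k → β), StrictMono c ∧ StrictMono r ∧ ∀ i, (c i, r (π i)) ∈ A

lemma HasPattern.of_image {α β α' β' : Type*} [LinearOrder α] [LinearOrder β] [LinearOrder α']
    [LinearOrder β'] {k : ℕ} {π : Equiv.Perm (Fin k)} {A : Finset (α × β)} {φ : α → α'}
    {ψ : β → β'} (hφ : Monotone φ) (hψ : Monotone ψ)
    (h : HasPattern π (A.image (Prod.map φ ψ))) : HasPattern π A := by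
  obtain ⟨c, r, hc, hr, hA⟩ := h
  simp only [Finset.mem_image, Prod.exists, Prod.map_apply, Prod.mk.injEq] at hA
  choose x y hxy hx hy using hA
  refine ⟨x, fun j => y (π.symm j), fun i j hij => ?_, fun i j hij => ?_, fun i => ?_⟩
  · exact hφ.reflect_lt (by rw [hx, hx]; exact hc hij)
  · exact hψ.reflect_lt (by rw [hy, hy]; simpa using hr hij)
  · simpa using hxy i

lemma HasPattern.of_swap {α β : Type*} [LinearOrder α] [LinearOrder β] {k : ℕ}
    {π : Equiv.Perm (Fin k)} {A : Finset (α × β)}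
    (h : HasPattern π.symm (A.image Prod.swap)) : HasPattern π A := by
  obtain ⟨c, r, hc, hr, hA⟩ := h
  refine ⟨r, c, hr, hc, fun i => ?_⟩
  have := hA (π i)
  simpa using this

/-- The points of `A` in the `s × s` block with index `b`. -/
def block (A : Finset (ℕ × ℕ)) (s : ℕ) (b : ℕ × ℕ) : Finset (ℕ × ℕ) :=
  A.filter fun p => Prod.map (· / s) (· / s) p = b

lemma mem_block {A : Finset (ℕ × ℕ)} {s : ℕ} {b p : ℕ × ℕ} :
    p ∈ block A s b ↔ p ∈ A ∧ p.1 / s = b.1 ∧ p.2 / s = b.2 := by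
  simp [block, Prod.ext_iff]

lemma image_fst_block_subset (A : Finset (ℕ × ℕ)) {s : ℕ} (hs : 0 < s) (b : ℕ × ℕ) :
    (block A s b).image Prod.fst ⊆ Finset.Ico (b.1 * s) (b.1 * s + s) := by
  intro x hx
  obtain ⟨p, hp, rfl⟩ := Finset.mem_image.1 hx
  have := (Nat.div_eq_iff hs).1 (mem_block.1 hp).2.1
  rw [Finset.mem_Ico]
  omega

lemma image_snd_block_subset (A : Finset (ℕ × ℕ)) {s : ℕ} (hs : 0 < s) (b : ℕ × ℕ) :
    (block A s b).image Prod.snd ⊆ Finset.Ico (b.2 * s) (b.2 * s + s) := by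
  intro x hx
  obtain ⟨p, hp, rfl⟩ := Finset.mem_image.1 hx
  have := (Nat.div_eq_iff hs).1 (mem_block.1 hp).2.2
  rw [Finset.mem_Ico]
  omega

/-- In a pattern-avoiding set, each column of blocks has boundedly many wide blocks. -/
lemma card_wide_le {k s a : ℕ} (hs : 0 < s) {π : Equiv.Perm (Fin k)}
    {A : Finset (ℕ × ℕ)} (hA : ¬ HasPattern π A) {W : Finset ℕ}
    (hW : ∀ b ∈ W, k ≤ ((block A s (a, b)).image Prod.fst).card) :
    W.card ≤ 2 ^ s * k := by
  by_contra! hlt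
  obtain ⟨S, -, hS⟩ := Finset.exists_lt_card_fiber_of_mul_lt_card_of_maps_to
    (s := W) (t := (Finset.Ico (a * s) (a * s + s)).powerset)
    (f := fun b => (block A s (a, b)).image Prod.fst) (n := k)
    (fun b _ => Finset.mem_powerset.2 (image_fst_block_subset A hs (a, b)))
    (by simpa using hlt)
  set F := W.filter fun b => (block A s (a, b)).image Prod.fst = S with hF
  have hmem : ∀ b ∈ F, (block A s (a, b)).image Prod.fst = S := fun b hb =>
    (Finset.mem_filter.1 hb).2
  obtain ⟨b₀, hb₀⟩ : F.Nonempty := Finset.card_pos.1 (by omega)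
  have hSk : k ≤ S.card := hmem b₀ hb₀ ▸ hW b₀ (Finset.mem_filter.1 hb₀).1
  let c : Fin k → ℕ := fun i => S.orderEmbOfFin rfl (Fin.castLE hSk i)
  let r : Fin k → ℕ := fun i => F.orderEmbOfFin rfl (Fin.castLE hS.le i)
  have hc : StrictMono c := (S.orderEmbOfFin rfl).strictMono.comp (Fin.strictMono_castLE hSk)
  have hr : StrictMono r := (F.orderEmbOfFin rfl).strictMono.comp (Fin.strictMono_castLE hS.le)
  have hex : ∀ i, ∃ y, (c i, y) ∈ A ∧ y / s = r (π i) := fun i => by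
    have h1 : c i ∈ (block A s (a, r (π i))).image Prod.fst := by
      rw [hmem _ (F.orderEmbOfFin_mem rfl _)]
      exact S.orderEmbOfFin_mem rfl _
    obtain ⟨⟨x, y⟩, hp, hx⟩ := Finset.mem_image.1 h1
    have := mem_block.1 hp
    exact ⟨y, by simpa [← hx] using this.1, this.2.2⟩
  choose y hy hys using hex
  refine hA ⟨c, fun j => y (π.symm j), hc, fun i j hij => ?_, fun i => by simpa using hy i⟩
  have hmono : Monotone fun z : ℕ => z / s := fun _ _ h => Nat.div_le_div_right h
  exact hmono.reflect_lt (by simpa [hys] using hr hij)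

lemma block_image_swap (A : Finset (ℕ × ℕ)) (s : ℕ) (b : ℕ × ℕ) :
    (block (A.image Prod.swap) s b.swap).image Prod.fst = (block A s b).image Prod.snd := by
  ext x
  simp only [Finset.mem_image, mem_block, Prod.exists, Prod.swap_prod_mk, Prod.mk.injEq,
    Prod.fst_swap, Prod.snd_swap]
  constructor
  · rintro ⟨u, v, ⟨⟨p, q, hA, rfl, rfl⟩, h1, h2⟩, rfl⟩
    exact ⟨p, q, ⟨hA, h2, h1⟩, rfl⟩
  · rintro ⟨u, v, ⟨hA, h1, h2⟩, rfl⟩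
    exact ⟨v, u, ⟨⟨u, v, hA, rfl, rfl⟩, h2, h1⟩, rfl⟩

lemma card_block_le (A : Finset (ℕ × ℕ)) {s : ℕ} (b : ℕ × ℕ) :
    (block A s b).card ≤
      ((block A s b).image Prod.fst).card * ((block A s b).image Prod.snd).card := by
  rw [← Finset.card_product]
  refine Finset.card_le_card fun p hp => Finset.mem_product.2 ⟨?_, ?_⟩
  · exact Finset.mem_image_of_mem _ hp
  · exact Finset.mem_image_of_mem _ hp

lemma image_div_subset {A : Finset (ℕ × ℕ)} {s M : ℕ}
    (hA : A ⊆ Finset.range (M * s) ×ˢ Finset.range (M * s)) :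
    A.image (Prod.map (· / s) (· / s)) ⊆ Finset.range M ×ˢ Finset.range M := by
  intro b hb
  obtain ⟨p, hp, rfl⟩ := Finset.mem_image.1 hb
  have := Finset.mem_product.1 (hA hp)
  simp only [Finset.mem_range] at this
  simp only [Finset.mem_product, Finset.mem_range, Prod.map_fst, Prod.map_snd]
  exact ⟨Nat.div_lt_of_lt_mul (by linarith [this.1, mul_comm M s]),
    Nat.div_lt_of_lt_mul (by linarith [this.2, mul_comm M s])⟩

lemma not_hasPattern_image_div {k : ℕ} {π : Equiv.Perm (Fin k)} {A : Finset (ℕ × ℕ)}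
    (hA : ¬ HasPattern π A) (s : ℕ) : ¬ HasPattern π (A.image (Prod.map (· / s) (· / s))) :=
  fun h => hA (h.of_image (fun _ _ h => Nat.div_le_div_right h)
    (fun _ _ h => Nat.div_le_div_right h))

/-- The Marcus–Tardos recursion. -/
lemma card_le_card_image_div {k s M : ℕ} (hs : 0 < s) {π : Equiv.Perm (Fin k)}
    {A : Finset (ℕ × ℕ)} (hA : ¬ HasPattern π A)
    (hAM : A ⊆ Finset.range (M * s) ×ˢ Finset.range (M * s)) :
    A.card ≤ (k - 1) ^ 2 * (A.image (Prod.map (· / s) (· / s))).card +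
      2 * (s ^ 2 * (2 ^ s * k)) * M := by
  classical
  set B := A.image (Prod.map (· / s) (· / s)) with hB
  have hBM : B ⊆ Finset.range M ×ˢ Finset.range M := image_div_subset hAM
  set w : ℕ × ℕ → ℕ := fun b => ((block A s b).image Prod.fst).card with hw
  set h : ℕ × ℕ → ℕ := fun b => ((block A s b).image Prod.snd).card with hh
  have hwide : (B.filter fun b => k ≤ w b).card ≤ 2 ^ s * k * M := by
    have := Finset.card_le_mul_card_image_of_maps_to (s := B.filter fun b => k ≤ w b)
      (t := Finset.range M) (f := Prod.fst)
      (fun b hb => (Finset.mem_product.1 (hBM (Finset.mem_filter.1 hb).1)).1) (2 ^ s * k)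
      (fun a _ => by
        rw [← Finset.card_image_of_injOn (f := Prod.snd)]
        · refine card_wide_le (a := a) hs hA fun b hb => ?_
          obtain ⟨⟨a', b'⟩, hp, rfl⟩ := Finset.mem_image.1 hb
          simp only [Finset.mem_filter] at hp
          obtain ⟨⟨-, hp⟩, rfl⟩ := hp
          exact hp
        · rintro ⟨p, q⟩ hp ⟨p', q'⟩ hp' hq
          simp only [Finset.coe_filter, Set.mem_ofPred_eq] at hp hp'
          exact Prod.ext (hp.2.trans hp'.2.symm) hq)
    simpa using this
  have htall : (B.filter fun b => k ≤ h b).card ≤ 2 ^ s * k * M := by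
    have := Finset.card_le_mul_card_image_of_maps_to (s := B.filter fun b => k ≤ h b)
      (t := Finset.range M) (f := Prod.snd)
      (fun b hb => (Finset.mem_product.1 (hBM (Finset.mem_filter.1 hb).1)).2) (2 ^ s * k)
      (fun a _ => by
        rw [← Finset.card_image_of_injOn (f := Prod.fst)]
        · refine card_wide_le (a := a) (π := π.symm) (A := A.image Prod.swap) hs
            (fun h => hA h.of_swap) fun b hb => ?_
          obtain ⟨⟨b', a'⟩, hp, rfl⟩ := Finset.mem_image.1 hb
          simp only [Finset.mem_filter] at hp
          obtain ⟨⟨-, hp⟩, rfl⟩ := hp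
          have hsw := block_image_swap A s (b', a')
          rw [Prod.swap_prod_mk] at hsw
          rw [hsw]
          exact hp
        · rintro ⟨p, q⟩ hp ⟨p', q'⟩ hp' hq
          simp only [Finset.coe_filter, Set.mem_ofPred_eq] at hp hp'
          exact Prod.ext hq (hp.2.trans hp'.2.symm))
    simpa using this
  have hblock : ∀ b ∈ B, (block A s b).card ≤
      (k - 1) ^ 2 + ((if k ≤ w b then s ^ 2 else 0) + if k ≤ h b then s ^ 2 else 0) := by
    intro b _
    have h0 : (block A s b).card ≤ w b * h b := card_block_le A b
    have h1 : w b ≤ s := by simpa using Finset.card_le_card (image_fst_block_subset A hs b)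
    have h2 : h b ≤ s := by simpa using Finset.card_le_card (image_snd_block_subset A hs b)
    have h3 : w b * h b ≤ s ^ 2 := by rw [sq]; exact Nat.mul_le_mul h1 h2
    split_ifs with h4 h5 h5
    · omega
    · omega
    · omega
    · have : w b * h b ≤ (k - 1) ^ 2 := by rw [sq]; exact Nat.mul_le_mul (by omega) (by omega)
      omega
  calc A.card = ∑ b ∈ B, (block A s b).card :=
        Finset.card_eq_sum_card_fiberwise fun p hp => Finset.mem_image_of_mem _ hp
    _ ≤ ∑ b ∈ B, ((k - 1) ^ 2 +
          ((if k ≤ w b then s ^ 2 else 0) + if k ≤ h b then s ^ 2 else 0)) :=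
        Finset.sum_le_sum hblock
    _ = (k - 1) ^ 2 * B.card + ((B.filter fun b => k ≤ w b).card * s ^ 2 +
          (B.filter fun b => k ≤ h b).card * s ^ 2) := by
        simp only [Finset.sum_add_distrib, ← Finset.sum_filter, Finset.sum_const, smul_eq_mul]
        ring
    _ ≤ (k - 1) ^ 2 * B.card + (2 ^ s * k * M * s ^ 2 + 2 ^ s * k * M * s ^ 2) := by gcongr
    _ = _ := by ring

/-- The Marcus–Tardos theorem (Füredi–Hajnal conjecture), for side lengths a power of `k ^ 2`. -/
lemma exists_card_le_of_not_hasPattern {k : ℕ} (hk : 0 < k) (π : Equiv.Perm (Fin k)) :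
    ∃ D : ℕ, ∀ t : ℕ, ∀ A ⊆ Finset.range ((k ^ 2) ^ t) ×ˢ Finset.range ((k ^ 2) ^ t),
      ¬ HasPattern π A → A.card ≤ D * (k ^ 2) ^ t := by
  set s := k ^ 2 with hs
  have hs0 : 0 < s := by positivity
  set D := 2 * (s ^ 2 * (2 ^ s * k)) with hD
  have hD0 : 0 < D := by positivity
  refine ⟨D, fun t => ?_⟩
  induction t with
  | zero =>
    intro A hA _
    have := Finset.card_le_card hA
    simp at this ⊢
    omega
  | succ t ih =>
    intro A hA hπ
    rw [pow_succ] at hA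
    have h1 := card_le_card_image_div hs0 hπ hA
    have h2 := ih _ (image_div_subset hA) (not_hasPattern_image_div hπ s)
    have h3 : (k - 1) ^ 2 + 1 ≤ s := by
      obtain ⟨j, rfl⟩ := Nat.exists_eq_succ_of_ne_zero hk.ne'
      simp only [hs, Nat.succ_eq_add_one, Nat.add_sub_cancel]
      nlinarith
    calc A.card ≤ (k - 1) ^ 2 * (D * s ^ t) + D * s ^ t :=
          h1.trans (by gcongr)
      _ = ((k - 1) ^ 2 + 1) * (D * s ^ t) := by ring
      _ ≤ s * (D * s ^ t) := by gcongr
      _ = D * s ^ (t + 1) := by ring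

open Classical in
/-- The subsets of `U` avoiding `π`. -/
noncomputable def avoiders {α β : Type*} [Preorder α] [Preorder β] {k : ℕ}
    (π : Equiv.Perm (Fin k)) (U : Finset (α × β)) : Finset (Finset (α × β)) :=
  U.powerset.filter fun A => ¬ HasPattern π A

lemma mem_avoiders {α β : Type*} [Preorder α] [Preorder β] {k : ℕ}
    {π : Equiv.Perm (Fin k)} {U A : Finset (α × β)} :
    A ∈ avoiders π U ↔ A ⊆ U ∧ ¬ HasPattern π A := by
  simp [avoiders]

lemma avoiders_subset {α β : Type*} [Preorder α] [Preorder β] {k : ℕ}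
    {π : Equiv.Perm (Fin k)} {U : Finset (α × β)} : avoiders π U ⊆ U.powerset := fun _ hA =>
  Finset.mem_powerset.2 (mem_avoiders.1 hA).1

lemma card_preimage_div_le {s : ℕ} (hs : 0 < s) (V B : Finset (ℕ × ℕ)) :
    (V.filter fun p => Prod.map (· / s) (· / s) p ∈ B).card ≤ s ^ 2 * B.card := by
  refine Finset.card_le_mul_card_image_of_maps_to (f := Prod.map (· / s) (· / s))
    (fun p hp => (Finset.mem_filter.1 hp).2) _ fun b _ => ?_
  refine (card_block_le _ b).trans ?_
  rw [sq]
  refine Nat.mul_le_mul ?_ ?_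
  · simpa using Finset.card_le_card (image_fst_block_subset _ hs b)
  · simpa using Finset.card_le_card (image_snd_block_subset _ hs b)

/-- Klazar's bound on the number of pattern-avoiding `0`-`1` matrices, for side lengths a power
of `k ^ 2`. -/
lemma exists_card_avoiders_pow_le {k : ℕ} (hk : 2 ≤ k) (π : Equiv.Perm (Fin k)) :
    ∃ E : ℕ, ∀ t : ℕ, (avoiders π
      (Finset.range ((k ^ 2) ^ t) ×ˢ Finset.range ((k ^ 2) ^ t))).card ≤ 2 ^ (E * (k ^ 2) ^ t) := by
  obtain ⟨D, hD⟩ := exists_card_le_of_not_hasPattern (by omega) π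
  set s := k ^ 2 with hs
  have hs2 : 2 ≤ s := by nlinarith
  refine ⟨s ^ 2 * D + 1, fun t => ?_⟩
  induction t with
  | zero =>
    calc _ ≤ (Finset.range (s ^ 0) ×ˢ Finset.range (s ^ 0)).powerset.card :=
          Finset.card_le_card avoiders_subset
      _ = 2 ^ 1 := by simp
      _ ≤ _ := Nat.pow_le_pow_right (by norm_num) (by simp)
  | succ t ih =>
    set U := Finset.range (s ^ t) ×ˢ Finset.range (s ^ t)
    set V := Finset.range (s ^ (t + 1)) ×ˢ Finset.range (s ^ (t + 1)) with hV
    have hstep : (avoiders π V).card ≤ 2 ^ (s ^ 2 * (D * s ^ t)) * (avoiders π U).card := by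
      refine Finset.card_le_mul_card_image_of_maps_to
        (f := fun A => A.image (Prod.map (· / s) (· / s))) (fun A hA => ?_) _ fun B hB => ?_
      · rw [mem_avoiders, hV, pow_succ] at hA
        exact mem_avoiders.2 ⟨image_div_subset hA.1, not_hasPattern_image_div hA.2 s⟩
      · have hB := mem_avoiders.1 hB
        calc _ ≤ (V.filter fun p => Prod.map (· / s) (· / s) p ∈ B).powerset.card := by
              refine Finset.card_le_card fun A hA => Finset.mem_powerset.2 fun p hp => ?_
              rw [Finset.mem_filter, mem_avoiders] at hA
              exact Finset.mem_filter.2 ⟨hA.1.1 hp, hA.2 ▸ Finset.mem_image_of_mem _ hp⟩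
          _ ≤ _ := by
              rw [Finset.card_powerset]
              refine Nat.pow_le_pow_right (by norm_num) ?_
              exact (card_preimage_div_le (by omega) V B).trans
                (Nat.mul_le_mul_left _ (hD t B hB.1 hB.2))
    calc _ ≤ 2 ^ (s ^ 2 * (D * s ^ t)) * 2 ^ ((s ^ 2 * D + 1) * s ^ t) :=
          hstep.trans (Nat.mul_le_mul_left _ ih)
      _ = 2 ^ ((s ^ 2 * D + (s ^ 2 * D + 1)) * s ^ t) := by rw [← pow_add]; ring_nf
      _ ≤ _ := by
          refine Nat.pow_le_pow_right (by norm_num) ?_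
          calc (s ^ 2 * D + (s ^ 2 * D + 1)) * s ^ t ≤ ((s ^ 2 * D + 1) * s) * s ^ t := by
                gcongr; nlinarith [Nat.zero_le (s ^ 2 * D)]
            _ = _ := by ring

/-- The number of elements of `Q` below a point. -/
def rank {α : Type*} [LinearOrder α] (Q : Finset α) (x : α) : ℕ := (Q.filter (· < x)).card

lemma rank_mono {α : Type*} [LinearOrder α] (Q : Finset α) : Monotone (rank Q) := fun _ _ h =>
  Finset.card_le_card fun _ hz => Finset.mem_filter.2
    ⟨(Finset.mem_filter.1 hz).1, (Finset.mem_filter.1 hz).2.trans_le h⟩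

lemma rank_strictMonoOn {α : Type*} [LinearOrder α] (Q : Finset α) :
    StrictMonoOn (rank Q) Q := fun x hx y _ h => by
  refine Finset.card_lt_card ((Finset.ssubset_iff_of_subset fun z hz => ?_).2 ⟨x, ?_, ?_⟩)
  · exact Finset.mem_filter.2 ⟨(Finset.mem_filter.1 hz).1, (Finset.mem_filter.1 hz).2.trans h⟩
  · exact Finset.mem_filter.2 ⟨hx, h⟩
  · simp

lemma rank_lt {α : Type*} [LinearOrder α] {Q : Finset α} {x : α} (hx : x ∈ Q) :
    rank Q x < Q.card :=
  Finset.card_lt_card (Finset.filter_ssubset.2 ⟨x, hx, lt_irrefl x⟩)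

/-- Boundedly exponentially many pattern-avoiding subsets of a grid. -/
lemma exists_card_avoiders_le {k : ℕ} (hk : 2 ≤ k) (π : Equiv.Perm (Fin k)) :
    ∃ c : ℕ, ∀ {α β : Type} [LinearOrder α] [LinearOrder β] (Q : Finset α) (V : Finset β),
      (avoiders π (Q ×ˢ V)).card ≤ c ^ (Q.card + V.card) := by
  obtain ⟨E, hE⟩ := exists_card_avoiders_pow_le hk π
  set s := k ^ 2 with hs
  have hs2 : 1 < s := by nlinarith
  refine ⟨2 ^ (E * s), fun {α β} _ _ Q V => ?_⟩
  set N := Q.card + V.card with hN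
  obtain hN0 | hN0 := Nat.eq_zero_or_pos N
  · have hQ : Q = ∅ := Finset.card_eq_zero.1 (by omega)
    calc _ ≤ (Q ×ˢ V).powerset.card := Finset.card_le_card avoiders_subset
      _ = _ := by simp [hQ, hN0]
  obtain ⟨t, hNt, htN⟩ : ∃ t, N ≤ s ^ t ∧ s ^ t ≤ s * N :=
    ⟨Nat.log s N + 1, (Nat.lt_pow_succ_log_self hs2 N).le, by
      rw [pow_succ, mul_comm]
      exact Nat.mul_le_mul_left _ (Nat.pow_log_le_self s hN0.ne')⟩
  have hinj : Set.InjOn (Prod.map (rank Q) (rank V)) (Q ×ˢ V : Finset (α × β)) := by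
    rw [Finset.coe_product]
    exact (rank_strictMonoOn Q).injOn.prodMap (rank_strictMonoOn V).injOn
  calc _ ≤ (avoiders π (Finset.range (s ^ t) ×ˢ Finset.range (s ^ t))).card := by
        refine Finset.card_le_card_of_injOn
          (fun A => A.image (Prod.map (rank Q) (rank V))) (fun A hA => ?_) ?_
        · have hA := mem_avoiders.1 (Finset.mem_coe.1 hA)
          refine Finset.mem_coe.2 (mem_avoiders.2 ⟨fun p hp => ?_,
            fun h => hA.2 (h.of_image (rank_mono Q) (rank_mono V))⟩)
          obtain ⟨q, hq, rfl⟩ := Finset.mem_image.1 hp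
          have hq := Finset.mem_product.1 (hA.1 hq)
          have h1 := rank_lt hq.1
          have h2 := rank_lt hq.2
          simp only [Finset.mem_product, Finset.mem_range, Prod.map_fst, Prod.map_snd]
          omega
        · intro A hA A' hA' h
          have hA := (mem_avoiders.1 (Finset.mem_coe.1 hA)).1
          have hA' := (mem_avoiders.1 (Finset.mem_coe.1 hA')).1
          refine Finset.coe_injective ((hinj.image_eq_image_iff
            (Finset.coe_subset.2 hA) (Finset.coe_subset.2 hA')).1 ?_)
          simpa only [Finset.coe_image] using congrArg (fun S : Finset (ℕ × ℕ) => (S : Set (ℕ × ℕ))) h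
    _ ≤ 2 ^ (E * s ^ t) := hE t
    _ ≤ 2 ^ (E * (s * N)) := Nat.pow_le_pow_right (by norm_num) (Nat.mul_le_mul_left _ htN)
    _ = _ := by rw [← pow_mul, mul_assoc]

/-- If the points are coloured with `m` colours, then at most `(m * C) ^ n` permutations have no copy
of `π` inside a colour class. -/
lemma exists_card_perm_avoiding_on_classes_le {k : ℕ} (hk : 2 ≤ k) (π : Equiv.Perm (Fin k)) :
    ∃ C : ℕ, ∀ (n : ℕ) {ι : Type} [Fintype ι] (f : Fin n → ι) (P : Equiv.Perm (Fin n) → Prop),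
      (∀ σ, P σ → ¬ ∃ x : Fin k → Fin n, StrictMono x ∧ (∀ i j, π i < π j ↔ σ (x i) < σ (x j)) ∧
        ∃ c, ∀ i, f (x i) = c) →
      Nat.card {σ // P σ} ≤ (Fintype.card ι * C) ^ n := by
  classical
  obtain ⟨c, hc⟩ := exists_card_avoiders_le hk π
  refine ⟨c ^ 2, fun n ι _ f P hP => ?_⟩
  let Q : ι → Finset (Fin n) := fun a => Finset.univ.filter fun v => f v = a
  let V : (Fin n → ι) → ι → Finset (Fin n) := fun g a => Finset.univ.filter fun v => g v = a
  have hsum : ∀ g : Fin n → ι, ∑ a, (V g a).card = n := fun g => by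
    simpa using (Finset.card_eq_sum_card_fiberwise (s := (Finset.univ : Finset (Fin n)))
      (t := Finset.univ) (f := g) (fun _ _ => Finset.mem_coe.2 (Finset.mem_univ _))).symm
  have hfib : ∀ g : Fin n → ι,
      (Finset.univ.filter fun σ : Equiv.Perm (Fin n) => P σ ∧ f ∘ σ.symm = g).card ≤
        (c ^ 2) ^ n := by
    intro g
    calc _ ≤ (Fintype.piFinset fun a => avoiders π (Q a ×ˢ V g a)).card := by
          refine Finset.card_le_card_of_injOn
            (fun σ a => (Q a).image fun v => (v, σ v)) (fun σ hσ => ?_) ?_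
          · simp only [Finset.coe_filter, Finset.mem_univ, true_and, Set.mem_ofPred_eq] at hσ
            obtain ⟨hσP, rfl⟩ := hσ
            refine Finset.mem_coe.2 (Fintype.mem_piFinset.2 fun a => mem_avoiders.2 ⟨?_, ?_⟩)
            · intro p hp
              obtain ⟨v, hv, rfl⟩ := Finset.mem_image.1 hp
              simpa [Q, V] using hv
            · rintro ⟨x, r, hx, hr, hA⟩
              have hA' : ∀ i, f (x i) = a ∧ σ (x i) = r (π i) := fun i => by
                simpa [Q] using hA i
              refine hP σ hσP ⟨x, hx, fun i j => ?_, a, fun i => (hA' i).1⟩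
              rw [(hA' i).2, (hA' j).2, hr.lt_iff_lt]
          · intro σ _ τ _ h
            ext1 v
            have h1 : (v, σ v) ∈ (Q (f v)).image fun v => (v, τ v) := by
              have h0 : ((Q (f v)).image fun v => (v, σ v)) = (Q (f v)).image fun v => (v, τ v) :=
                congrFun h (f v)
              rw [← h0]
              exact Finset.mem_image_of_mem (fun v => (v, σ v)) (by simp [Q])
            obtain ⟨u, -, hu⟩ := Finset.mem_image.1 h1
            obtain ⟨rfl, h2⟩ := Prod.mk.inj hu
            exact h2.symm
      _ ≤ ∏ a, c ^ ((Q a).card + (V g a).card) := by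
          rw [Fintype.card_piFinset]
          exact Finset.prod_le_prod' fun a _ => hc _ _
      _ = (c ^ 2) ^ n := by
          rw [Finset.prod_pow_eq_pow_sum, Finset.sum_add_distrib, hsum g,
            show ∑ a, (Q a).card = n from hsum f, ← pow_mul, two_mul]
  rw [Nat.card_eq_fintype_card, Fintype.card_subtype]
  calc _ ≤ (c ^ 2) ^ n * (Finset.univ : Finset (Fin n → ι)).card :=
        Finset.card_le_mul_card_image_of_maps_to (f := fun σ : Equiv.Perm (Fin n) => f ∘ σ.symm)
          (fun _ _ => Finset.mem_univ _) _ fun g _ => by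
            rw [Finset.filter_filter]
            exact hfib g
    _ = _ := by rw [Finset.card_univ, Fintype.card_fun, Fintype.card_fin, mul_pow, mul_comm]

/-- If the `k`-uniform hypergraph `Λ` on `{1,…,n}` contains a collection of
`L`-vertex cliques such that every vertex lies in at least `δ₀ > 0` and at most
`Δ₀` cliques of the collection, then the number of permutations `Λ`-avoiding `π`
is at most `(C · n · (log n)^(2+ε) / L)^n`. -/
theorem fixed_hypergraph_avoidance (k : ℕ) (hk : 2 ≤ k) (π : Equiv.Perm (Fin k))
    (ε δ₀ Δ₀ : ℝ) (hε : 0 < ε) (hδ₀ : 0 < δ₀) (hΔ₀ : 0 < Δ₀) :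
    ∃ C : ℝ, ∀ n L : ℕ, 0 < n → k ≤ L → L ≤ n →
      ∀ Λ : Finset (Finset (Fin n)), (∀ e ∈ Λ, e.card = k) →
      ∀ 𝒞 : Finset (Finset (Fin n)),
        (∀ Q ∈ 𝒞, Q.card = L ∧ ∀ s ⊆ Q, s.card = k → s ∈ Λ) →
        (∀ v : Fin n,
          δ₀ ≤ ((𝒞.filter (fun Q => v ∈ Q)).card : ℝ) ∧
          ((𝒞.filter (fun Q => v ∈ Q)).card : ℝ) ≤ Δ₀) →
        (Nat.card {σ : Equiv.Perm (Fin n) // LambdaAvoids π Λ σ} : ℝ) ≤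
          (C * n * Real.log n ^ ((2 : ℝ) + ε) / L) ^ n := by
  classical
  obtain ⟨C, hC⟩ := exists_card_perm_avoiding_on_classes_le hk π
  have hlog2 : (0 : ℝ) < Real.log 2 := Real.log_pos (by norm_num)
  set l : ℝ := Real.log 2 ^ ((2 : ℝ) + ε) with hl
  have hl0 : 0 < l := Real.rpow_pos_of_pos hlog2 _
  refine ⟨Δ₀ * C / l, fun n L hn hkL hLn Λ hΛ 𝒞 h𝒞 hdeg => ?_⟩
  have hL0 : (0 : ℝ) < L := by exact_mod_cast (by omega : 0 < L)
  have hcover : ∀ v : Fin n, ∃ q : 𝒞, v ∈ q.1 := fun v => by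
    have h1 : (0 : ℝ) < (𝒞.filter (fun Q => v ∈ Q)).card := hδ₀.trans_le (hdeg v).1
    obtain ⟨q, hq⟩ := Finset.card_pos.1 (Nat.cast_pos.1 h1)
    exact ⟨⟨q, (Finset.mem_filter.1 hq).1⟩, (Finset.mem_filter.1 hq).2⟩
  choose f hf using hcover
  have hcount := hC n f (LambdaAvoids π Λ) fun σ hσ ⟨x, hx, hxσ, q, hq⟩ => by
    refine hσ ⟨x, hx, hxσ, (h𝒞 q.1 q.2).2 _ (fun v hv => ?_) ?_⟩
    · obtain ⟨i, -, rfl⟩ := Finset.mem_image.1 hv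
      exact hq i ▸ hf (x i)
    · rw [Finset.card_image_of_injective _ hx.injective, Finset.card_univ, Fintype.card_fin]
  have hm : (𝒞.card : ℝ) * L ≤ Δ₀ * n := by
    have h1 : 𝒞.card * L = ∑ v : Fin n, (𝒞.filter (fun Q => v ∈ Q)).card := by
      have h2 := Finset.sum_card_bipartiteAbove_eq_sum_card_bipartiteBelow (s := 𝒞)
        (t := (Finset.univ : Finset (Fin n))) (fun Q v => v ∈ Q)
      refine Eq.trans ?_ h2
      rw [Finset.sum_congr rfl fun Q hQ => ?_, Finset.sum_const, smul_eq_mul]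
      simpa [Finset.bipartiteAbove] using (h𝒞 Q hQ).1
    calc (𝒞.card : ℝ) * L = ∑ v : Fin n, ((𝒞.filter (fun Q => v ∈ Q)).card : ℝ) := by
          exact_mod_cast h1
      _ ≤ ∑ _v : Fin n, Δ₀ := Finset.sum_le_sum fun v _ => (hdeg v).2
      _ = Δ₀ * n := by simp [mul_comm]
  have hlog : l ≤ Real.log n ^ ((2 : ℝ) + ε) :=
    Real.rpow_le_rpow hlog2.le
      (Real.log_le_log (by norm_num) (by exact_mod_cast (by omega : 2 ≤ n))) (by linarith)
  calc (Nat.card {σ : Equiv.Perm (Fin n) // LambdaAvoids π Λ σ} : ℝ)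
      ≤ ((𝒞.card : ℝ) * C) ^ n := by
        rw [Fintype.card_coe] at hcount
        exact_mod_cast hcount
    _ ≤ _ := by
        refine pow_le_pow_left₀ (by positivity) ?_ n
        have h1 : (𝒞.card : ℝ) ≤ Δ₀ * n / L := (le_div_iff₀ hL0).2 hm
        calc (𝒞.card : ℝ) * C ≤ Δ₀ * n / L * C := by gcongr
          _ = Δ₀ * C / l * n * l / L := by field_simp
          _ ≤ _ := by gcongr
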